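/- Let n, n' ∈ C⁰(P) be continuous tangent unit-vector fields on P, and let n̂, n̂' ∈ C⁰(P̂) denote their restrictions to the truncated polyhedron P̂. Then n and n' are homotopic in C⁰(P) if and only if n̂ and n̂' are homotopic in C⁰(P̂). -/

import Mathlib

open Matrix Set MeasureTheory
open scoped Classical

noncomputable section

/-- Points of `ℝ³`. -/
abbrev V3 := Fin 3 → ℝ

/-- The unit sphere `S² ⊂ ℝ³`. -/
def sphereS : Set V3 := {x | x ⬝ᵥ x = 1}

/-- Rodrigues rotation of `v` by angle `θ` about the unit axis `F`. -/
def rot3 (F : V3) (θ : ℝ) (v : V3) : V3 :=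
  Real.cos θ • v + Real.sin θ • (crossProduct F v) + ((1 - Real.cos θ) * (F ⬝ᵥ v)) • F

/-- The point at fraction `ρ` of arclength along the shortest geodesic on the
unit sphere from `p` to `a` (for `a ≠ -p`). -/
def geo (p a : V3) (ρ : ℝ) : V3 :=
  if p = a then p
  else (Real.sin ((1 - ρ) * Real.arccos (p ⬝ᵥ a)) / Real.sin (Real.arccos (p ⬝ᵥ a))) • p +
       (Real.sin (ρ * Real.arccos (p ⬝ᵥ a)) / Real.sin (Real.arccos (p ⬝ᵥ a))) • a

/-- `ξ` is the continuous angle lift of the tangent field `n` along the path `z`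
(defined on `[0,1]`), `η ∈ (-π,π)` the smallest-magnitude angle between the endpoint
values, and `κ` the resulting kink number: `2πκ = ξ(1) - η`. -/
def IsKinkAlong (Fn : V3) (n : V3 → V3) (z : ℝ → V3) (κ : ℤ) : Prop :=
  ∃ ξ : ℝ → ℝ, ContinuousOn ξ (Set.Icc 0 1) ∧ ξ 0 = 0 ∧
    (∀ t ∈ Set.Icc (0:ℝ) 1, n (z t) = rot3 Fn (ξ t) (n (z 0))) ∧
    ∃ η : ℝ, η ∈ Set.Ioo (-Real.pi) Real.pi ∧ n (z 1) = rot3 Fn η (n (z 0)) ∧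
      2 * Real.pi * (κ : ℝ) = ξ 1 - η

/-- `z` is a `2π`-periodic parameterization of a loop around the centre `ctr`, lying in the
plane through `ctr` with normal `N`, positively oriented with respect to `N` (the angle
`θ` increases by `2π` over a period). -/
def PosLoopParam (N ctr : V3) (z : ℝ → V3) : Prop :=
  Continuous z ∧ (∀ φ, z (φ + 2 * Real.pi) = z φ) ∧
  ∃ e₁ e₂ : V3, e₁ ⬝ᵥ e₁ = 1 ∧ e₂ ⬝ᵥ e₂ = 1 ∧ e₁ ⬝ᵥ e₂ = 0 ∧ crossProduct e₁ e₂ = N ∧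
    ∃ θ r : ℝ → ℝ, Continuous θ ∧ Monotone θ ∧ (∀ φ, θ (φ + 2 * Real.pi) = θ φ + 2 * Real.pi) ∧
      (∀ φ, 0 < r φ) ∧
      ∀ φ, z φ = ctr + r φ • (Real.cos (θ φ) • e₁ + Real.sin (θ φ) • e₂)

/-- The map `S² → S²` obtained by gluing, along the equator, the map
`ν(ρ,φ) = n(ρ z(φ) + (1-ρ) ctr)` (on the upper hemisphere) with the map
`ν₀(ρ,φ) = g_ρ(-s, n(z(φ)))` (on the lower hemisphere), where `(ρ,φ)` are the polar
coordinates of the first two coordinates. -/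
def wrapMap (n : V3 → V3) (z : ℝ → V3) (ctr s : V3) : V3 → V3 := fun x =>
  if 0 ≤ x 2 then
    n ((Real.sqrt ((x 0) ^ 2 + (x 1) ^ 2)) • z (Complex.arg ((x 0 : ℂ) + (x 1 : ℂ) * Complex.I))
      + (1 - Real.sqrt ((x 0) ^ 2 + (x 1) ^ 2)) • ctr)
  else
    geo (-s) (n (z (Complex.arg ((x 0 : ℂ) + (x 1 : ℂ) * Complex.I))))
      (Real.sqrt ((x 0) ^ 2 + (x 1) ^ 2))

/-- Homotopy of maps of the unit sphere `S²` to itself. -/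
def SphHomotopic (f g : V3 → V3) : Prop :=
  ∃ H : ℝ → V3 → V3,
    ContinuousOn (fun q : ℝ × V3 => H q.1 q.2) (Set.Icc (0:ℝ) 1 ×ˢ sphereS) ∧
    (∀ t ∈ Set.Icc (0:ℝ) 1, Set.MapsTo (H t) sphereS sphereS) ∧
    (∀ x ∈ sphereS, H 0 x = f x) ∧ (∀ x ∈ sphereS, H 1 x = g x)

/-- The standard degree-`k` self-map of `S²`: in cylindrical coordinates it multiplies
the azimuthal angle by `k`, fixing the vertical coordinate. -/
def powMap (k : ℤ) : V3 → V3 := fun x =>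
  if ((x 0 : ℂ) + (x 1 : ℂ) * Complex.I) = 0 then x
  else
    ![‖(x 0 : ℂ) + (x 1 : ℂ) * Complex.I‖ *
        ((((x 0 : ℂ) + (x 1 : ℂ) * Complex.I) /
          (‖(x 0 : ℂ) + (x 1 : ℂ) * Complex.I‖ : ℂ)) ^ k).re,
      ‖(x 0 : ℂ) + (x 1 : ℂ) * Complex.I‖ *
        ((((x 0 : ℂ) + (x 1 : ℂ) * Complex.I) /
          (‖(x 0 : ℂ) + (x 1 : ℂ) * Complex.I‖ : ℂ)) ^ k).im,
      x 2]

/-- `deg` is a Brouwer degree for self-maps of `S²`: it is invariant under homotopy of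
continuous self-maps of the sphere, and assigns degree `k` to the standard map `powMap k`.
(These axioms determine `deg` uniquely on continuous self-maps of `S²`, by Hopf's theorem.) -/
def DegreeTheory (deg : (V3 → V3) → ℤ) : Prop :=
  (∀ f g : V3 → V3, ContinuousOn f sphereS → Set.MapsTo f sphereS sphereS →
      ContinuousOn g sphereS → Set.MapsTo g sphereS sphereS →
      SphHomotopic f g → deg f = deg g) ∧
  (∀ k : ℤ, deg (powMap k) = k)

/-- The pullback under `u : ℝ² → S²` of the (normalized) area 2-form of `S²`,
evaluated on the standard basis of `ℝ²`: `u ⋅ (∂₁ u × ∂₂ u)`. -/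
def pullA (u : ℝ × ℝ → V3) (p : ℝ × ℝ) : ℝ :=
  u p ⬝ᵥ crossProduct (fderiv ℝ u p (1, 0)) (fderiv ℝ u p (0, 1))

/-- The integral `∫_A n*ω` of the pullback under `n` of the area form `ω` of `S²`, over a
planar region `A` lying in the plane through `o` spanned by the orthonormal pair `e₁, e₂`
(the pair orienting the plane). -/
def faceInt (n : V3 → V3) (o e₁ e₂ : V3) (A : Set V3) : ℝ :=
  ∫ p : ℝ × ℝ in {q : ℝ × ℝ | o + q.1 • e₁ + q.2 • e₂ ∈ A},
    pullA (fun q : ℝ × ℝ => n (o + q.1 • e₁ + q.2 • e₂)) p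

/-- The 1-form `γ = (1 - cos α) dβ` on `S² - {s}` (where `(α,β)` are spherical polar
coordinates with south pole at `s`, and `e₁, e₂` is an orthonormal azimuthal frame with
`e₁ ×₃ e₂ = -s`), evaluated at the point `v` on the tangent vector `w`. -/
def gammaForm (s e₁ e₂ : V3) (v w : V3) : ℝ :=
  if (v ⬝ᵥ e₁) ^ 2 + (v ⬝ᵥ e₂) ^ 2 = 0 then 0
  else (1 + v ⬝ᵥ s) *
    (((v ⬝ᵥ e₁) * (w ⬝ᵥ e₂) - (v ⬝ᵥ e₂) * (w ⬝ᵥ e₁)) / ((v ⬝ᵥ e₁) ^ 2 + (v ⬝ᵥ e₂) ^ 2))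

/-- The closed spherical geodesic triangle with vertices `a`, `b`, `c` (pairwise
non-antipodal): the radial projection to the sphere of the planar triangle with these
vertices. Its sides are the shortest geodesic arcs joining consecutive vertices. -/
def sphTri (a b c : V3) : Set V3 :=
  {x | ∃ α β γ : ℝ, 0 ≤ α ∧ 0 ≤ β ∧ 0 ≤ γ ∧ α • a + β • b + γ • c ≠ 0 ∧
    x = (Real.sqrt ((α • a + β • b + γ • c) ⬝ᵥ (α • a + β • b + γ • c)))⁻¹ •
      (α • a + β • b + γ • c)}

/-- The shortest geodesic arc on the sphere from `a` to `b` (for `a ≠ -b`). -/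
def sphArc (a b : V3) : Set V3 :=
  {x | ∃ α β : ℝ, 0 ≤ α ∧ 0 ≤ β ∧ α • a + β • b ≠ 0 ∧
    x = (Real.sqrt ((α • a + β • b) ⬝ᵥ (α • a + β • b)))⁻¹ • (α • a + β • b)}

/-- The oriented area `A(a,b,c)` of the spherical geodesic triangle with vertices
`a`, `b`, `c`: `A = 2 arg((1 + a⋅b + b⋅c + c⋅a) + i (a×b)⋅c)`, with `arg ∈ (-π, π]`. -/
def sphA (a b c : V3) : ℝ :=
  2 * Complex.arg (((1 + a ⬝ᵥ b + b ⬝ᵥ c + c ⬝ᵥ a : ℝ) : ℂ) +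
    ((crossProduct a b ⬝ᵥ c : ℝ) : ℂ) * Complex.I)

/-- `σ(a,b,c)` relative to the point `s`: equal to `sgn((a×b)⋅s)` if `s` lies in the
spherical triangle with vertices `a`, `b`, `c`, and `0` otherwise. -/
def sphSigma (s a b c : V3) : ℝ :=
  if s ∈ sphTri a b c then Real.sign (crossProduct a b ⬝ᵥ s) else 0

/-- A compact convex polyhedron `P̄ ⊂ ℝ³` with nonempty interior: its vertices `vert`,
faces `face` (with outward unit normals `Fnormal` and supporting planes
`{x | x ⋅ Fnormal c = foffset c}`), edges `edge` (segments between vertices), together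
with the truncation data: for each vertex `a` a plane through `cpt a` with outward unit
normal `Cnormal a` separating `vert a` from the other vertices, the planes being pairwise
disjoint within `P̄`.  The combinatorial data records, for each face `c`, its `m c`
vertices `fvert c 0, fvert c 1, …` and edges `fedge c i` (from `fvert c i` to
`fvert c (i+1)`) in cyclic order, positively oriented with respect to the outward normal;
and, for each vertex `a`, its `vm a` incident edges `vedge a i` and faces `vface a i`
(with `vface a i` containing the consecutive edges `vedge a i` and `vedge a (i+1)`) in
cyclic order, positively oriented with respect to the outward normal of the cleaved face. -/
structure PolyCtx where
  nv : ℕ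
  ne : ℕ
  nf : ℕ
  Pbar : Set V3
  vert : Fin nv → V3
  face : Fin nf → Set V3
  Fnormal : Fin nf → V3
  foffset : Fin nf → ℝ
  edge : Fin ne → Set V3
  esrc : Fin ne → Fin nv
  etgt : Fin ne → Fin nv
  edgeDir : Fin ne → V3
  cpt : Fin nv → V3
  Cnormal : Fin nv → V3
  m : Fin nf → ℕ
  fvert : Fin nf → ℕ → Fin nv
  fedge : Fin nf → ℕ → Fin ne
  vm : Fin nv → ℕ
  vedge : Fin nv → ℕ → Fin ne
  vface : Fin nv → ℕ → Fin nf
  compact : IsCompact Pbar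
  convex : Convex ℝ Pbar
  int_nonempty : (interior Pbar).Nonempty
  hull : Pbar = convexHull ℝ (Set.range vert)
  vert_extreme : ∀ a, vert a ∉ convexHull ℝ (Set.range vert \ {vert a})
  vert_inj : Function.Injective vert
  Fnormal_unit : ∀ c, Fnormal c ⬝ᵥ Fnormal c = 1
  face_def : ∀ c, face c = {x ∈ Pbar | x ⬝ᵥ Fnormal c = foffset c}
  face_supp : ∀ c, ∀ x ∈ Pbar, x ⬝ᵥ Fnormal c ≤ foffset c
  frontier_eq : frontier Pbar = ⋃ c, face c
  edge_def : ∀ b, edge b = segment ℝ (vert (esrc b)) (vert (etgt b))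
  edge_proper : ∀ b, esrc b ≠ etgt b
  edgeDir_unit : ∀ b, edgeDir b ⬝ᵥ edgeDir b = 1
  edgeDir_dir : ∀ b, ∃ lam : ℝ, 0 < lam ∧ vert (etgt b) - vert (esrc b) = lam • edgeDir b
  edge_two_faces : ∀ b, ∃ c c', edge b ⊆ face c ∧ edge b ⊆ face c' ∧
    crossProduct (Fnormal c) (Fnormal c') ≠ 0
  Cnormal_unit : ∀ a, Cnormal a ⬝ᵥ Cnormal a = 1
  sep_vert : ∀ a, 0 < (vert a - cpt a) ⬝ᵥ Cnormal a
  sep_other : ∀ a a', a' ≠ a → (vert a' - cpt a) ⬝ᵥ Cnormal a < 0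
  cleave_sub : ∀ a a' : Fin nv, ∀ x ∈ Pbar, (x - cpt a) ⬝ᵥ Cnormal a = 0 →
    (x - cpt a') ⬝ᵥ Cnormal a' ≤ 0
  m_ge : ∀ c, 3 ≤ m c
  fvert_per : ∀ c i, fvert c (i + m c) = fvert c i
  fedge_per : ∀ c i, fedge c (i + m c) = fedge c i
  fvert_inj : ∀ c, ∀ i j : ℕ, i < j → j < m c → fvert c i ≠ fvert c j
  fedge_seg : ∀ c i, edge (fedge c i) = segment ℝ (vert (fvert c i)) (vert (fvert c (i + 1)))
  fedge_sub : ∀ c i, edge (fedge c i) ⊆ face c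
  vm_ge : ∀ a, 3 ≤ vm a
  vedge_per : ∀ a i, vedge a (i + vm a) = vedge a i
  vface_per : ∀ a i, vface a (i + vm a) = vface a i
  vedge_inj : ∀ a, ∀ i j : ℕ, i < j → j < vm a → vedge a i ≠ vedge a j
  vedge_mem : ∀ a i, vert a ∈ edge (vedge a i)
  vface_between : ∀ a i, edge (vedge a i) ⊆ face (vface a i) ∧
    edge (vedge a (i + 1)) ⊆ face (vface a i)

namespace PolyCtx

variable (P : PolyCtx)

/-- `P`: the polyhedron `P̄` with its vertices removed. -/
def Pset : Set V3 := P.Pbar \ Set.range P.vert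

/-- The closed half-space `R^a` cut off by the cleaving plane at the vertex `a`. -/
def Rhalf (a : Fin P.nv) : Set V3 := {x | (x - P.cpt a) ⬝ᵥ P.Cnormal a ≤ 0}

/-- The intersection of all the half-spaces `R^a`. -/
def Rall : Set V3 := ⋂ a, P.Rhalf a

/-- The truncated polyhedron `P̂ = P ∩ ⋂ₐ R^a`. -/
def PhatSet : Set V3 := P.Pset ∩ P.Rall

/-- The cleaved face `Ĉ^a = C^a ∩ P`. -/
def Chat (a : Fin P.nv) : Set V3 := {x | (x - P.cpt a) ⬝ᵥ P.Cnormal a = 0} ∩ P.Pset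

/-- The truncated face `F̂^c = F^c ∩ ⋂ₐ R^a`. -/
def Fhat (c : Fin P.nf) : Set V3 := P.face c ∩ P.Rall

/-- The cleaved edge `B̂^{ac} = Ĉ^a ∩ F̂^c`. -/
def Bhat (a : Fin P.nv) (c : Fin P.nf) : Set V3 := P.Chat a ∩ P.Fhat c

/-- The truncated edge `Ê^b = E^b ∩ ⋂ₐ R^a`. -/
def Ehat (b : Fin P.ne) : Set V3 := P.edge b ∩ P.Rall

/-- The boundary `∂Ĉ^a` of the cleaved face: the union of its cleaved edges. -/
def bdChat (a : Fin P.nv) : Set V3 := ⋃ c, P.Bhat a c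

/-- The boundary `∂F̂^c` of the truncated face: its truncated edges and cleaved edges. -/
def bdFhat (c : Fin P.nf) : Set V3 :=
  (⋃ i ∈ Finset.range (P.m c), P.Ehat (P.fedge c i)) ∪
    ⋃ i ∈ Finset.range (P.m c), P.Bhat (P.fvert c i) c

/-- The boundary `∂P̂` of the truncated polyhedron: cleaved faces and truncated faces. -/
def bdPhat : Set V3 := (⋃ a, P.Chat a) ∪ ⋃ c, P.Fhat c

/-- `n ∈ C⁰(P)`: a continuous unit-vector field on `P`, tangent to each face. -/
def MemC0P (n : V3 → V3) : Prop :=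
  ContinuousOn n P.Pset ∧ (∀ x ∈ P.Pset, n x ∈ sphereS) ∧
  ∀ c, ∀ x ∈ P.face c ∩ P.Pset, n x ⬝ᵥ P.Fnormal c = 0

/-- `n ∈ C⁰(P̂)`: a continuous unit-vector field on `P̂`, tangent to each truncated
face `F̂^c` (but not necessarily to the cleaved faces). -/
def MemC0Phat (n : V3 → V3) : Prop :=
  ContinuousOn n P.PhatSet ∧ (∀ x ∈ P.PhatSet, n x ∈ sphereS) ∧
  ∀ c, ∀ x ∈ P.Fhat c, n x ⬝ᵥ P.Fnormal c = 0

/-- Homotopy in `C⁰(P)`. -/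
def HomotopicP (n n' : V3 → V3) : Prop :=
  ∃ H : ℝ → V3 → V3,
    ContinuousOn (fun q : ℝ × V3 => H q.1 q.2) (Set.Icc (0:ℝ) 1 ×ˢ P.Pset) ∧
    (∀ t ∈ Set.Icc (0:ℝ) 1, P.MemC0P (H t)) ∧
    (∀ x ∈ P.Pset, H 0 x = n x) ∧ (∀ x ∈ P.Pset, H 1 x = n' x)

/-- Homotopy in `C⁰(P̂)`. -/
def HomotopicPhat (n n' : V3 → V3) : Prop :=
  ∃ H : ℝ → V3 → V3,
    ContinuousOn (fun q : ℝ × V3 => H q.1 q.2) (Set.Icc (0:ℝ) 1 ×ˢ P.PhatSet) ∧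
    (∀ t ∈ Set.Icc (0:ℝ) 1, P.MemC0Phat (H t)) ∧
    (∀ x ∈ P.PhatSet, H 0 x = n x) ∧ (∀ x ∈ P.PhatSet, H 1 x = n' x)

/-- The edge orientation `e^b(n) = ε`: `n` has the constant value `ε` on `Ê^b`. -/
def IsEdgeOrient (b : Fin P.ne) (n : V3 → V3) (ε : V3) : Prop :=
  ∀ x ∈ P.Ehat b, n x = ε

/-- `z : [0,1] → ℝ³` is a continuous injective parameterization of the cleaved edge
`B̂^{ac}`, positively oriented with respect to the outward normal `F^c` (the face
`F̂^c` lies on the positive side of `F^c × (z 1 - z 0)`). -/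
def IsPosParamSeg (a : Fin P.nv) (c : Fin P.nf) (z : ℝ → V3) : Prop :=
  ContinuousOn z (Set.Icc 0 1) ∧ z '' Set.Icc 0 1 = P.Bhat a c ∧
  Set.InjOn z (Set.Icc 0 1) ∧
  ∀ x ∈ P.Fhat c, 0 ≤ (x - z 0) ⬝ᵥ crossProduct (P.Fnormal c) (z 1 - z 0)

/-- The kink number `k^{ac}(n) = κ`. -/
def HasKink (a : Fin P.nv) (c : Fin P.nf) (n : V3 → V3) (κ : ℤ) : Prop :=
  ∃ z : ℝ → V3, P.IsPosParamSeg a c z ∧ IsKinkAlong (P.Fnormal c) n z κ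

/-- `s ∈ S²` is admissible: not orthogonal to any face normal. -/
def AdmissibleS (s : V3) : Prop := s ∈ sphereS ∧ ∀ c, s ⬝ᵥ P.Fnormal c ≠ 0

/-- The wrapping number `w^a(n) = w`, computed (relative to a Brouwer degree `deg` and
an admissible reference point `s`) as the degree of the map `S² → S²` glued from the
restriction of `n` to the cleaved face `Ĉ^a` and the geodesic contraction of its boundary
values to `-s`, using an interior point `ctr` of `Ĉ^a` and a positively oriented
`2π`-periodic parameterization `z` of `∂Ĉ^a`. -/
def HasWrap (deg : (V3 → V3) → ℤ) (s : V3) (a : Fin P.nv) (n : V3 → V3) (w : ℤ) : Prop :=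
  ∃ ctr z, ctr ∈ P.Chat a ∧ ctr ∉ P.bdChat a ∧
    PosLoopParam (P.Cnormal a) ctr z ∧ Set.range z = P.bdChat a ∧
    deg (wrapMap n z ctr s) = w

/-- `n` and `n'` have the same invariants: equal edge orientations, kink numbers and
wrapping numbers. -/
def SameInv (deg : (V3 → V3) → ℤ) (s : V3) (n n' : V3 → V3) : Prop :=
  (∀ b : Fin P.ne, Set.EqOn n n' (P.Ehat b)) ∧
  (∀ a c, ∀ κ : ℤ, P.HasKink a c n κ ↔ P.HasKink a c n' κ) ∧
  (∀ a, ∀ w : ℤ, P.HasWrap deg s a n w ↔ P.HasWrap deg s a n' w)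

end PolyCtx

namespace PolyCtx

variable (P : PolyCtx)

/-- The signed height of `x` above the cleaving plane at the vertex `a`. -/
def gh (a : Fin P.nv) (x : V3) : ℝ := (x - P.cpt a) ⬝ᵥ P.Cnormal a

lemma gh_comb (a : Fin P.nv) (x y : V3) (α β : ℝ) (h : α + β = 1) :
    P.gh a (α • x + β • y) = α * P.gh a x + β * P.gh a y := by
  have hβ : β = 1 - α := by linarith
  subst hβ
  simp only [gh, sub_dotProduct, add_dotProduct, smul_dotProduct, smul_eq_mul]
  ring

lemma gh_cont (a : Fin P.nv) : Continuous (P.gh a) := by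
  unfold gh dotProduct
  fun_prop

lemma vert_mem (a : Fin P.nv) : P.vert a ∈ P.Pbar := by
  rw [P.hull]; exact subset_convexHull ℝ _ ⟨a, rfl⟩

lemma decomp (a : Fin P.nv) {x : V3} (hx : x ∈ P.Pbar) :
    ∃ w : ℝ, ∃ y : V3, 0 ≤ w ∧ w ≤ 1 ∧ y ∈ P.Pbar ∧ P.gh a y < 0 ∧
      x = w • P.vert a + (1 - w) • y := by
  have hne : (Set.range P.vert \ {P.vert a}).Nonempty := by
    have hb := P.edge_proper (P.vedge a 0)
    by_cases h : P.esrc (P.vedge a 0) = a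
    · refine ⟨P.vert (P.etgt (P.vedge a 0)), ⟨_, rfl⟩, ?_⟩
      intro h'
      have := P.vert_inj h'
      exact hb (h.trans this.symm)
    · refine ⟨P.vert (P.esrc (P.vedge a 0)), ⟨_, rfl⟩, ?_⟩
      intro h'
      exact h (P.vert_inj h')
  have hins : Set.range P.vert = insert (P.vert a) (Set.range P.vert \ {P.vert a}) := by
    rw [Set.insert_sdiff_singleton, Set.insert_eq_of_mem (Set.mem_range_self a)]
  have hx' := hx
  rw [P.hull, hins, convexHull_insert hne, convexJoin_singleton_left] at hx'
  obtain ⟨y, hy, hxy⟩ := Set.mem_iUnion₂.1 hx'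
  obtain ⟨α, β, hα, hβ, hαβ, rfl⟩ := hxy
  have hconv : Convex ℝ {z | P.gh a z < 0} := by
    intro z hz z' hz' s t hs ht hst
    simp only [Set.mem_ofPred_eq] at *
    rw [P.gh_comb a z z' s t hst]
    rcases hs.eq_or_lt with h | h
    · subst h
      have : t = 1 := by linarith
      subst this; linarith
    · nlinarith
  refine ⟨α, y, hα, by linarith, ?_, ?_, ?_⟩
  · rw [P.hull]; exact convexHull_mono Set.sdiff_subset hy
  · refine convexHull_min ?_ hconv hy
    rintro _ ⟨⟨a', rfl⟩, h⟩
    refine P.sep_other a a' ?_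
    rintro rfl
    exact h rfl
  · congr 2; linarith

lemma gh_lt (a : Fin P.nv) {x : V3} (hx : x ∈ P.Pbar) (hne : x ≠ P.vert a) :
    P.gh a x < P.gh a (P.vert a) := by
  obtain ⟨w, y, h0, h1, -, hy, rfl⟩ := P.decomp a hx
  rw [P.gh_comb a _ _ _ _ (by ring)]
  have hv : 0 < P.gh a (P.vert a) := P.sep_vert a
  have : w < 1 := by
    refine lt_of_le_of_ne h1 ?_
    rintro rfl
    exact hne (by simp)
  nlinarith

lemma gh_disj (a a' : Fin P.nv) (haa : a' ≠ a) {x : V3} (hx : x ∈ P.Pbar) (hg : 0 < P.gh a x) :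
    P.gh a' x ≤ 0 := by
  by_contra! h
  have h1 : P.gh a (P.vert a') < 0 := P.sep_other a a' haa
  have h2 : 0 < P.gh a' (P.vert a') := P.sep_vert a'
  set s := P.gh a x / (P.gh a x - P.gh a (P.vert a')) with hs
  have hd : 0 < P.gh a x - P.gh a (P.vert a') := by linarith
  have hs0 : 0 < s := by positivity
  have hs1 : s < 1 := by rw [hs, div_lt_one hd]; linarith
  have hz : (1 - s) • x + s • P.vert a' ∈ P.Pbar :=
    P.convex hx (P.vert_mem a') (by linarith) hs0.le (by ring)
  have hz0 : P.gh a ((1 - s) • x + s • P.vert a') = 0 := by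
    rw [P.gh_comb a _ _ _ _ (by ring), hs]
    field_simp
    ring
  have hz1 : P.gh a' ((1 - s) • x + s • P.vert a') ≤ 0 := P.cleave_sub a a' _ hz hz0
  rw [P.gh_comb a' _ _ _ _ (by ring)] at hz1
  nlinarith

lemma vert_face (a : Fin P.nv) (c : Fin P.nf) {x : V3} (hx : x ∈ P.face c)
    (hg : 0 < P.gh a x) : P.vert a ⬝ᵥ P.Fnormal c = P.foffset c := by
  rw [P.face_def] at hx
  obtain ⟨hxP, hxc⟩ := hx
  obtain ⟨w, y, h0, h1, hyP, hy, rfl⟩ := P.decomp a hxP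
  rw [P.gh_comb a _ _ _ _ (by ring)] at hg
  have hw : 0 < w := by
    refine lt_of_le_of_ne h0 ?_
    rintro rfl
    linarith
  have e1 := P.face_supp c _ (P.vert_mem a)
  have e2 := P.face_supp c _ hyP
  simp only [add_dotProduct, smul_dotProduct, smul_eq_mul] at hxc
  nlinarith

/-- The radial push away from the vertices (for `s = 1`, a retraction onto `P̂`). -/
def push (s : ℝ) (x : V3) : V3 :=
  x + ∑ a, (s * (max 0 (P.gh a x) / (P.gh a (P.vert a) - P.gh a x))) • (x - P.vert a)

lemma push_of_nonpos (s : ℝ) {x : V3} (h : ∀ a, P.gh a x ≤ 0) : P.push s x = x := by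
  unfold push
  simp [max_eq_left (h _)]

lemma push_of_pos (s : ℝ) {x : V3} (hx : x ∈ P.Pbar) (a : Fin P.nv) (h : 0 < P.gh a x) :
    P.push s x = x + (s * (P.gh a x / (P.gh a (P.vert a) - P.gh a x))) • (x - P.vert a) := by
  unfold push
  rw [Finset.sum_eq_single a]
  · rw [max_eq_right h.le]
  · intro b _ hb
    rw [max_eq_left (P.gh_disj a b hb hx h)]
    simp
  · simp

lemma mem_Rall {x : V3} : x ∈ P.Rall ↔ ∀ a, P.gh a x ≤ 0 := by
  simp [Rall, Rhalf, gh]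

lemma push_zero (x : V3) : P.push 0 x = x := by simp [push]

lemma gh_add (a : Fin P.nv) (x v : V3) (r : ℝ) :
    P.gh a (x + r • (x - v)) = P.gh a x + r * (P.gh a x - P.gh a v) := by
  simp only [gh, sub_dotProduct, add_dotProduct, smul_dotProduct, smul_eq_mul]
  ring

lemma push_mem {s : ℝ} (hs : s ∈ Set.Icc (0:ℝ) 1) {x : V3} (hx : x ∈ P.Pset) :
    P.push s x ∈ P.Pset := by
  obtain ⟨hs0, hs1⟩ := hs
  by_cases hall : ∀ a, P.gh a x ≤ 0
  · rwa [P.push_of_nonpos s hall]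
  push Not at hall
  obtain ⟨a, ha⟩ := hall
  have hxP := hx.1
  have hxa : x ≠ P.vert a := fun h => hx.2 ⟨a, h.symm⟩
  have hlt := P.gh_lt a hxP hxa
  have hv : 0 < P.gh a (P.vert a) := P.sep_vert a
  rw [P.push_of_pos s hxP a ha]
  have hd : 0 < P.gh a (P.vert a) - P.gh a x := by linarith
  set k := P.gh a x / (P.gh a (P.vert a) - P.gh a x) with hk
  have hk0 : 0 < k := by positivity
  have hkd : k * (P.gh a (P.vert a) - P.gh a x) = P.gh a x := by
    rw [hk]; field_simp
  refine ⟨?_, ?_⟩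
  · obtain ⟨w, y, h0, h1, hyP, hy, hxe⟩ := P.decomp a hxP
    have hge : P.gh a x = w * P.gh a (P.vert a) + (1 - w) * P.gh a y := by
      conv_lhs => rw [hxe]
      exact P.gh_comb a _ _ _ _ (by ring)
    have hle : (1 + k) * (1 - w) ≤ 1 := by
      have hD : 0 < P.gh a (P.vert a) - P.gh a y := by linarith
      have : (1 + k) * (1 - w) * (P.gh a (P.vert a) - P.gh a y) = P.gh a (P.vert a) := by
        have h2 : (1 - w) * (P.gh a (P.vert a) - P.gh a y) = P.gh a (P.vert a) - P.gh a x := by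
          rw [hge]; ring
        rw [mul_assoc, h2]; linarith
      by_contra! hc
      nlinarith
    have hle' : (1 + s * k) * (1 - w) ≤ 1 := by
      have : s * k ≤ k := by nlinarith
      nlinarith
    have hge0 : 0 ≤ (1 + s * k) * (1 - w) := by
      have : 0 ≤ s * k := by positivity
      have : 0 ≤ 1 - w := by linarith
      positivity
    have key : x + (s * k) • (x - P.vert a) =
        (1 - (1 + s * k) * (1 - w)) • P.vert a + ((1 + s * k) * (1 - w)) • y := by
      clear_value k
      clear hge
      rw [hxe]
      module
    rw [key]
    exact P.convex (P.vert_mem a) hyP (by linarith) hge0 (by ring)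
  · rintro ⟨a', h⟩
    by_cases haa : a' = a
    · subst haa
      have : (1 + s * k) • (x - P.vert a') = 0 := by
        have h3 : x + (s * k) • (x - P.vert a') - P.vert a' = 0 := by rw [← h]; simp
        rw [← h3]; module
      rcases smul_eq_zero.1 this with h4 | h4
      · have : 0 ≤ s * k := by positivity
        linarith
      · exact hxa (sub_eq_zero.1 h4)
    · have h5 : P.gh a (P.vert a') < 0 := P.sep_other a a' haa
      rw [h, P.gh_add] at h5
      nlinarith

lemma push_one {x : V3} (hx : x ∈ P.Pset) : P.push 1 x ∈ P.PhatSet := by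
  have hmem := P.push_mem (s := 1) ⟨zero_le_one, le_rfl⟩ hx
  refine ⟨hmem, P.mem_Rall.2 ?_⟩
  by_cases hall : ∀ a, P.gh a x ≤ 0
  · rwa [P.push_of_nonpos 1 hall]
  push Not at hall
  obtain ⟨a, ha⟩ := hall
  have hxa : x ≠ P.vert a := fun h => hx.2 ⟨a, h.symm⟩
  have hlt := P.gh_lt a hx.1 hxa
  intro a'
  refine P.cleave_sub a a' _ hmem.1 ?_
  change P.gh a _ = 0
  rw [P.push_of_pos 1 hx.1 a ha, P.gh_add]
  have hd : P.gh a (P.vert a) - P.gh a x ≠ 0 := by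
    have : 0 < P.gh a (P.vert a) - P.gh a x := by linarith
    exact this.ne'
  field_simp
  ring

lemma push_face {s : ℝ} (hs : s ∈ Set.Icc (0:ℝ) 1) {c : Fin P.nf} {x : V3}
    (hx : x ∈ P.face c ∩ P.Pset) : P.push s x ∈ P.face c := by
  have hmem := P.push_mem hs hx.2
  rw [P.face_def]
  refine ⟨hmem.1, ?_⟩
  have hxc : x ⬝ᵥ P.Fnormal c = P.foffset c := by
    have := hx.1
    rw [P.face_def] at this
    exact this.2
  by_cases hall : ∀ a, P.gh a x ≤ 0
  · rwa [P.push_of_nonpos s hall]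
  push Not at hall
  obtain ⟨a, ha⟩ := hall
  rw [P.push_of_pos s hx.2.1 a ha]
  simp only [add_dotProduct, smul_dotProduct, sub_dotProduct, smul_eq_mul, hxc,
    P.vert_face a c hx.1 ha]
  ring

lemma push_cont :
    ContinuousOn (fun q : ℝ × V3 => P.push q.1 q.2) (Set.Icc (0:ℝ) 1 ×ˢ P.Pset) := by
  unfold push
  refine continuousOn_snd.add (continuousOn_finsetSum _ fun a _ => ?_)
  have hg : ContinuousOn (fun q : ℝ × V3 => P.gh a q.2) (Set.Icc (0:ℝ) 1 ×ˢ P.Pset) :=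
    ((P.gh_cont a).comp continuous_snd).continuousOn
  refine ContinuousOn.smul (continuousOn_fst.mul (ContinuousOn.div ?_ ?_ ?_)) ?_
  · exact (continuous_const.max ((P.gh_cont a).comp continuous_snd)).continuousOn
  · exact continuousOn_const.sub hg
  · rintro ⟨t, x⟩ ⟨-, hx⟩
    have := P.gh_lt a hx.1 fun h => hx.2 ⟨a, h.symm⟩
    exact (sub_pos.2 this).ne'
  · exact continuousOn_snd.sub continuousOn_const

lemma homP_mk (n n' : V3 → V3) (H : ℝ → V3 → V3)
    (hc : ContinuousOn (fun q : ℝ × V3 => H q.1 q.2) (Set.Icc (0:ℝ) 1 ×ˢ P.Pset))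
    (h1 : ∀ t ∈ Set.Icc (0:ℝ) 1, ∀ x ∈ P.Pset, H t x ∈ sphereS)
    (h2 : ∀ t ∈ Set.Icc (0:ℝ) 1, ∀ c, ∀ x ∈ P.face c ∩ P.Pset, H t x ⬝ᵥ P.Fnormal c = 0)
    (h3 : ∀ x ∈ P.Pset, H 0 x = n x) (h4 : ∀ x ∈ P.Pset, H 1 x = n' x) :
    P.HomotopicP n n' := by
  refine ⟨H, hc, fun t ht => ⟨?_, h1 t ht, h2 t ht⟩, h3, h4⟩
  exact hc.comp (f := fun x : V3 => (t, x)) (by fun_prop) fun x hx => ⟨ht, hx⟩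

lemma homP_symm {n n' : V3 → V3} (h : P.HomotopicP n n') : P.HomotopicP n' n := by
  obtain ⟨H, hc, hm, h0, h1⟩ := h
  have hI : ∀ t ∈ Set.Icc (0:ℝ) 1, 1 - t ∈ Set.Icc (0:ℝ) 1 := fun t ht =>
    ⟨by linarith [ht.2], by linarith [ht.1]⟩
  refine ⟨fun t => H (1 - t), ?_, fun t ht => hm _ (hI t ht), ?_, ?_⟩
  · exact hc.comp (f := fun q : ℝ × V3 => (1 - q.1, q.2)) (by fun_prop)
      fun q hq => ⟨hI _ hq.1, hq.2⟩
  · simpa using h1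
  · simpa using h0

lemma homP_trans {n n' n'' : V3 → V3} (h : P.HomotopicP n n') (h' : P.HomotopicP n' n'') :
    P.HomotopicP n n'' := by
  obtain ⟨H, hc, hm, h0, h1⟩ := h
  obtain ⟨K, kc, km, k0, k1⟩ := h'
  refine ⟨fun t => if t ≤ 1 / 2 then H (2 * t) else K (2 * t - 1), ?_, ?_, ?_, ?_⟩
  · have hset : Set.Icc (0:ℝ) 1 ×ˢ P.Pset =
        (Set.Icc (0:ℝ) 1 ×ˢ P.Pset) ∩ {q | q.1 ≤ 1 / 2} ∪
        (Set.Icc (0:ℝ) 1 ×ˢ P.Pset) ∩ {q | 1 / 2 ≤ q.1} := by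
      rw [← Set.inter_union_distrib_left, eq_comm, Set.inter_eq_left]
      intro q _
      exact le_total q.1 (1 / 2)
    have A : ContinuousOn (fun q : ℝ × V3 => H (2 * q.1) q.2)
        ((Set.Icc (0:ℝ) 1 ×ˢ P.Pset) ∩ {q | q.1 ≤ 1 / 2}) := by
      refine hc.comp (f := fun q : ℝ × V3 => (2 * q.1, q.2)) (by fun_prop) ?_
      rintro q ⟨⟨hq, hx⟩, hq'⟩
      simp only [Set.mem_ofPred_eq] at hq'
      exact ⟨⟨by linarith [hq.1], by linarith⟩, hx⟩
    have B : ContinuousOn (fun q : ℝ × V3 => K (2 * q.1 - 1) q.2)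
        ((Set.Icc (0:ℝ) 1 ×ˢ P.Pset) ∩ {q | 1 / 2 ≤ q.1}) := by
      refine kc.comp (f := fun q : ℝ × V3 => (2 * q.1 - 1, q.2)) (by fun_prop) ?_
      rintro q ⟨⟨hq, hx⟩, hq'⟩
      simp only [Set.mem_ofPred_eq] at hq'
      exact ⟨⟨by linarith, by linarith [hq.2]⟩, hx⟩
    have A' : ContinuousOn (fun q : ℝ × V3 =>
        (if q.1 ≤ 1 / 2 then H (2 * q.1) else K (2 * q.1 - 1)) q.2)
        ((Set.Icc (0:ℝ) 1 ×ˢ P.Pset) ∩ {q | q.1 ≤ 1 / 2}) := by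
      refine A.congr ?_
      rintro q ⟨-, hq'⟩
      simp only [Set.mem_ofPred_eq] at hq'
      simp only [if_pos hq']
    have B' : ContinuousOn (fun q : ℝ × V3 =>
        (if q.1 ≤ 1 / 2 then H (2 * q.1) else K (2 * q.1 - 1)) q.2)
        ((Set.Icc (0:ℝ) 1 ×ˢ P.Pset) ∩ {q | 1 / 2 ≤ q.1}) := by
      refine B.congr ?_
      rintro q ⟨⟨-, hx⟩, hq'⟩
      simp only [Set.mem_ofPred_eq] at hq'
      by_cases hq : q.1 ≤ 1 / 2
      · have : q.1 = 1 / 2 := le_antisymm hq hq'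
        simp only [this, le_refl, if_true]
        norm_num
        rw [h1 _ hx, k0 _ hx]
      · simp only [if_neg hq]
    have c1 : IsClosed {q : ℝ × V3 | q.1 ≤ 1 / 2} :=
      isClosed_le continuous_fst continuous_const
    have c2 : IsClosed {q : ℝ × V3 | 1 / 2 ≤ q.1} :=
      isClosed_le continuous_const continuous_fst
    intro q hq
    rw [hset, continuousWithinAt_union]
    constructor
    · by_cases hq1 : q ∈ {q : ℝ × V3 | q.1 ≤ 1 / 2}
      · exact A' q ⟨hq, hq1⟩
      · refine continuousWithinAt_of_notMem_closure fun hcl => hq1 ?_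
        exact closure_minimal Set.inter_subset_right c1 hcl
    · by_cases hq1 : q ∈ {q : ℝ × V3 | 1 / 2 ≤ q.1}
      · exact B' q ⟨hq, hq1⟩
      · refine continuousWithinAt_of_notMem_closure fun hcl => hq1 ?_
        exact closure_minimal Set.inter_subset_right c2 hcl
  · intro t ht
    by_cases h : t ≤ 1 / 2
    · simp only [if_pos h]
      exact hm _ ⟨by linarith [ht.1], by linarith⟩
    · simp only [if_neg h]
      push Not at h
      exact km _ ⟨by linarith, by linarith [ht.2]⟩
  · intro x hx
    norm_num
    exact h0 x hx
  · intro x hx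
    norm_num
    exact k1 x hx

lemma hom_push {n : V3 → V3} (hn : P.MemC0P n) :
    P.HomotopicP n (fun x => n (P.push 1 x)) := by
  refine P.homP_mk _ _ (fun s x => n (P.push s x)) ?_ ?_ ?_ ?_ ?_
  · exact hn.1.comp P.push_cont fun q hq => P.push_mem hq.1 hq.2
  · exact fun t ht x hx => hn.2.1 _ (P.push_mem ht hx)
  · exact fun t ht c x hx => hn.2.2 c _ ⟨P.push_face ht hx, P.push_mem ht hx.2⟩
  · intro x _
    simp only [P.push_zero]
  · exact fun x _ => rfl

end PolyCtx

/-- Two tangent unit-vector fields on `P` are homotopic in `C⁰(P)` if and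
only if their restrictions to the truncated polyhedron `P̂` are homotopic in `C⁰(P̂)`. -/
theorem stmt_0 (P : PolyCtx) (n n' : V3 → V3)
    (hn : P.MemC0P n) (hn' : P.MemC0P n') :
    P.HomotopicP n n' ↔ P.HomotopicPhat n n' := by
  constructor
  · rintro ⟨H, hc, hm, h0, h1⟩
    have hsub : P.PhatSet ⊆ P.Pset := Set.inter_subset_left
    refine ⟨H, hc.mono (Set.prod_mono le_rfl hsub), fun t ht => ⟨?_, ?_, ?_⟩,
      fun x hx => h0 x (hsub hx), fun x hx => h1 x (hsub hx)⟩
    · exact (hm t ht).1.mono hsub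
    · exact fun x hx => (hm t ht).2.1 x (hsub hx)
    · intro c x hx
      have hxP : x ∈ P.Pbar := by
        have := hx.1
        rw [P.face_def] at this
        exact this.1
      refine (hm t ht).2.2 c x ⟨hx.1, hxP, ?_⟩
      rintro ⟨a, rfl⟩
      have h2 := P.mem_Rall.1 hx.2 a
      have h3 : 0 < P.gh a (P.vert a) := P.sep_vert a
      linarith
  · rintro ⟨H, hc, hm, h0, h1⟩
    refine P.homP_trans (P.hom_push hn) (P.homP_trans ?_ (P.homP_symm (P.hom_push hn')))
    have hI : (1:ℝ) ∈ Set.Icc (0:ℝ) 1 := ⟨zero_le_one, le_rfl⟩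
    refine P.homP_mk _ _ (fun t x => H t (P.push 1 x)) ?_ ?_ ?_ ?_ ?_
    · have hp : ContinuousOn (fun q : ℝ × V3 => P.push 1 q.2) (Set.Icc (0:ℝ) 1 ×ˢ P.Pset) :=
        P.push_cont.comp (f := fun q : ℝ × V3 => ((1:ℝ), q.2)) (by fun_prop)
          fun q hq => ⟨hI, hq.2⟩
      exact hc.comp (f := fun q : ℝ × V3 => (q.1, P.push 1 q.2)) (continuousOn_fst.prodMk hp)
        fun q hq => ⟨hq.1, P.push_one hq.2⟩
    · exact fun t ht x hx => (hm t ht).2.1 _ (P.push_one hx)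
    · exact fun t ht c x hx => (hm t ht).2.2 c _ ⟨P.push_face hI hx, (P.push_one hx.2).2⟩
    · exact fun x hx => h0 _ (P.push_one hx)
    · exact fun x hx => h1 _ (P.push_one hx)
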